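/- Let c = (c₁,…,cₙ) ∈ 𝒜⁺ be dense, let e < f be ears of c, and let ℓ ∈ {1,…,n} with ℓ ∉ {e, e+1, …, f} and m_ℓ = {e, f}. Then either c = (1,1,1) or f = e + 2. -/

import Mathlib

open Matrix Finset

/-- The matrix `η(a)` with rows `(a, -1)` and `(1, 0)`. -/
def etaM (a : ℤ) : Matrix (Fin 2) (Fin 2) ℤ := !![a, -1; 1, 0]

/-- The set `𝒜⁺` of η-sequences, as an inductive predicate on lists of integers. -/
inductive IsEta : List ℤ → Prop
  | base : IsEta [0, 0]
  | rotate {c : List ℤ} : IsEta c → IsEta (c.rotate 1)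
  | reverse {c : List ℤ} : IsEta c → IsEta c.reverse
  | expand {a b : ℤ} {t : List ℤ} : IsEta (a :: b :: t) → IsEta ((a + 1) :: 1 :: (b + 1) :: t)

/-- The `i`-th entry (1-indexed) of a sequence. -/
def entryOf (c : List ℤ) (i : ℕ) : ℤ := c.getD (i - 1) 0

/-- `φ_i(j)`: `0` if `i = j`; the (2,1)-entry of `η(c_i)⋯η(c_{j-1})` if `i < j`;
the (2,1)-entry of `η(c_j)⋯η(c_{i-1})` if `j < i`.  (Indices are 1-based.) -/
def phi (c : List ℤ) (i j : ℕ) : ℤ :=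
  if i = j then 0
  else if i < j then (((c.drop (i - 1)).take (j - i)).map etaM).prod 1 0
  else (((c.drop (j - 1)).take (i - j)).map etaM).prod 1 0

open Classical in
/-- `m_i`: the set of positions `j ∈ {1,…,n}` where `φ_i` attains its maximum. -/
noncomputable def mset (c : List ℤ) (i : ℕ) : Finset ℕ :=
  (Finset.Icc 1 c.length).filter (fun j => ∀ l ∈ Finset.Icc 1 c.length, phi c i l ≤ phi c i j)

/-- `i ⊕ k`: addition of 1-based indices, wrapping around modulo `n` (for `i + k ≤ 2n`). -/
def addIdx (n i k : ℕ) : ℕ := if i + k ≤ n then i + k else i + k - n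

/-- `c` is dense if for every `i ∈ {1,…,n}`, `|m_i| > 1` or `|m_{i+1}| > 1`
(indices taken cyclically). -/
def DenseSeq (c : List ℤ) : Prop :=
  ∀ i ∈ Finset.Icc 1 c.length,
    1 < (mset c i).card ∨ 1 < (mset c (addIdx c.length i 1)).card

/-- `c` is fan-shaped if a cyclic rotation of `c` equals `(n-2, 1, 2, …, 2, 1)`. -/
def IsFan (c : List ℤ) : Prop :=
  ∃ k, c.rotate k =
    ((c.length : ℤ) - 2) :: 1 :: (List.replicate (c.length - 3) (2 : ℤ) ++ [1])

/-- The product `η(c₁)⋯η(c_k)`. -/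
def etaProd (c : List ℤ) (k : ℕ) : Matrix (Fin 2) (Fin 2) ℤ := ((c.take k).map etaM).prod

/-- The products `η(c₁)⋯η(c_k)` for the periodic continuation of `c`. -/
def etaPer (c : List ℤ) : ℕ → Matrix (Fin 2) (Fin 2) ℤ
  | 0 => 1
  | k + 1 => etaPer c k * etaM (c.getD (k % c.length) 0)

/-- The determinant formed by the first columns of two matrices. -/
def colDet (A B : Matrix (Fin 2) (Fin 2) ℤ) : ℤ := A 0 0 * B 1 0 - A 1 0 * B 0 0

/-- The determinant of the `i`-th and `j`-th vector of the periodic continuation of `c`. -/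
def perDet (c : List ℤ) (i j : ℕ) : ℤ := colDet (etaPer c i) (etaPer c j)

lemma etaM_det (a : ℤ) : (etaM a).det = 1 := by simp [etaM, Matrix.det_fin_two]

lemma etaProd_det (c : List ℤ) (k : ℕ) : (etaProd c k).det = 1 := by
  unfold etaProd
  induction c.take k with
  | nil => simp
  | cons a t ih => simp [Matrix.det_mul, etaM_det, ih]

lemma colDet_mul {A : Matrix (Fin 2) (Fin 2) ℤ} (hA : A.det = 1) (B : Matrix (Fin 2) (Fin 2) ℤ) :
    colDet A (A * B) = B 1 0 := by
  rw [Matrix.det_fin_two] at hA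
  simp only [colDet, Matrix.mul_apply, Fin.sum_univ_two]
  linear_combination (B 1 0) * hA

lemma etaProd_eq_mul (c : List ℤ) {i j : ℕ} (hij : i ≤ j) :
    etaProd c j = etaProd c i * (((c.drop i).take (j - i)).map etaM).prod := by
  obtain ⟨d, rfl⟩ := Nat.exists_eq_add_of_le hij
  simp [etaProd, List.take_add]

lemma colDet_etaProd (c : List ℤ) {i j : ℕ} (hij : i ≤ j) :
    colDet (etaProd c i) (etaProd c j) = (((c.drop i).take (j - i)).map etaM).prod 1 0 := by
  rw [etaProd_eq_mul c hij, colDet_mul (etaProd_det c i)]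

lemma etaProd_succ (c : List ℤ) {i : ℕ} (hi : i < c.length) :
    etaProd c (i + 1) = etaProd c i * etaM (c.getD i 0) := by
  rw [etaProd, ← List.take_append_getElem hi]
  simp only [etaProd, List.map_append, List.prod_append, List.map_cons, List.map_nil,
    List.prod_singleton, List.getD_eq_getElem _ _ hi]

lemma colDet_etaProd_succ (c : List ℤ) {i : ℕ} (hi : i < c.length) :
    colDet (etaProd c i) (etaProd c (i + 1)) = 1 := by
  rw [etaProd_succ c hi, colDet_mul (etaProd_det c i)]
  simp [etaM]

/-- The product of all `η(c_i)` is `-1`, and all proper prefixes have positive (2,1)-entry. -/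
def EtaPos (c : List ℤ) : Prop :=
  etaProd c c.length = -1 ∧ ∀ k, 0 < k → k < c.length → 0 < etaProd c k 1 0

lemma EtaPos.colDet_pos {c : List ℤ} (h : EtaPos c) {i j : ℕ} (hij : i < j) (hj : j ≤ c.length)
    (h0 : 0 < i ∨ j < c.length) : 0 < colDet (etaProd c i) (etaProd c j) := by
  obtain ⟨h1, h2⟩ := h
  rcases Nat.eq_zero_or_pos i with rfl | hi
  · simpa [colDet, etaProd] using h2 j hij (by omega)
  rcases hj.eq_or_lt with rfl | hj
  · simpa [colDet, h1] using h2 i hi hij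
  induction j, hij using Nat.le_induction with
  | base => rw [colDet_etaProd_succ c (by omega)]; exact one_pos
  | succ j hij ih =>
    have e1 := ih (by omega) (by omega) (by omega)
    have e2 := colDet_etaProd_succ c (i := j) (by omega)
    have yi := h2 i hi (by omega)
    have yj := h2 j (by omega) (by omega)
    have yj' := h2 (j + 1) (by omega) hj
    refine pos_of_mul_pos_right (a := etaProd c j 1 0) ?_ yj.le
    have : etaProd c j 1 0 * colDet (etaProd c i) (etaProd c (j + 1)) =
        etaProd c (j + 1) 1 0 * colDet (etaProd c i) (etaProd c j) + etaProd c i 1 0 := by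
      unfold colDet at *
      linear_combination (etaProd c i 1 0) * e2
    rw [this]
    positivity

lemma prod_map_reverse (t : List ℤ) :
    (t.reverse.map etaM).prod = !![1, 0; 0, -1] * (t.map etaM).prodᵀ * !![1, 0; 0, -1] := by
  induction t with
  | nil => ext i j; fin_cases i <;> fin_cases j <;> simp [Matrix.mul_apply]
  | cons a t ih =>
    simp only [List.reverse_cons, List.map_append, List.prod_append, ih, List.map_cons,
      List.prod_cons, List.map_nil, List.prod_nil, mul_one, Matrix.transpose_mul]
    generalize (t.map etaM).prod = M
    rw [Mᵀ.eta_fin_two, (etaM a)ᵀ.eta_fin_two]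
    ext i j
    fin_cases i <;> fin_cases j <;> simp [etaM, add_comm]

lemma EtaPos.rotate {c : List ℤ} (h : EtaPos c) : EtaPos (c.rotate 1) := by
  cases c with
  | nil => simpa using h
  | cons a t =>
    have hp : ∀ k, etaProd (a :: t) (k + 1) = etaM a * etaProd t k := by intro k; simp [etaProd]
    have hq : ∀ k ≤ t.length, etaProd (t ++ [a]) k = etaProd t k := by
      intro k hk; simp [etaProd, List.take_append_of_le_length hk]
    simp only [List.rotate_cons_succ, List.rotate_zero]
    refine ⟨?_, fun k hk hkn => ?_⟩
    · have h1 := h.1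
      rw [List.length_cons, hp] at h1
      have h2 : etaProd t t.length * etaM a = -1 := by
        rw [← neg_eq_iff_eq_neg, ← neg_mul] at h1 ⊢
        rw [neg_mul, ← mul_neg] at h1
        exact mul_eq_one_comm.mp h1
      rw [← h2]
      simp [etaProd]
    · simp only [List.length_append, List.length_cons, List.length_nil] at hkn
      rw [hq k (by omega)]
      have := h.colDet_pos (i := 1) (j := k + 1) (by omega) (by simp; omega) (by simp)
      have h1 : etaProd (a :: t) 1 = etaM a := by simp [etaProd]
      rwa [h1, hp, colDet_mul (etaM_det a)] at this

lemma EtaPos.reverse {c : List ℤ} (h : EtaPos c) : EtaPos c.reverse := by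
  refine ⟨?_, fun k hk hkn => ?_⟩
  · have h1 := h.1
    simp only [etaProd, List.take_length] at h1 ⊢
    rw [prod_map_reverse, h1]
    ext i j; fin_cases i <;> fin_cases j <;> simp [Matrix.mul_apply]
  · rw [List.length_reverse] at hkn
    obtain ⟨m, hm⟩ : ∃ m, c.length = m + 1 + k := ⟨c.length - k - 1, by omega⟩
    have e1 : etaProd c (m + 1) * ((c.drop (m + 1)).map etaM).prod = -1 := by
      rw [← h.1]; simp only [etaProd, List.take_length]
      rw [← List.prod_append, ← List.map_append, List.take_append_drop]
    have e2 : etaProd c.reverse k 1 0 = - ((c.drop (m + 1)).map etaM).prod 0 1 := by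
      rw [etaProd, List.take_reverse, prod_map_reverse, show c.length - k = m + 1 by omega]
      generalize ((c.drop (m + 1)).map etaM).prod = M
      rw [Mᵀ.eta_fin_two]
      simp
    generalize ((c.drop (m + 1)).map etaM).prod = M at e1 e2
    have e3 : M 0 1 = etaProd c (m + 1) 0 1 := by
      have hd := etaProd_det c (m + 1)
      rw [Matrix.det_fin_two] at hd
      have a1 := congrFun (congrFun e1 0) 1
      have a2 := congrFun (congrFun e1 1) 1
      simp [Matrix.mul_apply, Fin.sum_univ_two] at a1 a2
      linear_combination -(M 0 1) * hd
        + (etaProd c (m + 1) 1 1) * a1 - (etaProd c (m + 1) 0 1) * a2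
    have hs : ∀ i < c.length, etaProd c (i + 1) 0 1 = - etaProd c i 0 0 := by
      intro i hi
      rw [etaProd_succ c hi]
      simp [etaM, Matrix.mul_apply, Fin.sum_univ_two]
    have hs' : ∀ i < c.length, etaProd c (i + 1) 1 1 = - etaProd c i 1 0 := by
      intro i hi
      rw [etaProd_succ c hi]
      simp [etaM, Matrix.mul_apply, Fin.sum_univ_two]
    rw [e2, e3, hs m (by omega), neg_neg]
    have b1 := hs (m + k) (by omega)
    have b2 := hs' (m + k) (by omega)
    rw [show m + k + 1 = c.length by omega, h.1] at b1 b2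
    replace b1 : etaProd c (m + k) 0 0 = 0 := by simpa using b1
    replace b2 : etaProd c (m + k) 1 0 = 1 := by simpa using b2.symm
    have := h.colDet_pos (i := m) (j := m + k) (by omega) (by omega) (by omega)
    simpa [colDet, b1, b2] using this

lemma etaM_expand (a b : ℤ) : etaM (a + 1) * (etaM 1 * etaM (b + 1)) = etaM a * etaM b := by
  ext i j; fin_cases i <;> fin_cases j <;> simp [etaM, Matrix.mul_apply, Fin.sum_univ_two] <;> ring

lemma EtaPos.expand {a b : ℤ} {t : List ℤ} (h : EtaPos (a :: b :: t)) :
    EtaPos ((a + 1) :: 1 :: (b + 1) :: t) := by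
  have hp : ∀ k, etaProd ((a + 1) :: 1 :: (b + 1) :: t) (k + 3) =
      etaProd (a :: b :: t) (k + 2) := by
    intro k
    simp only [etaProd, List.take_succ_cons, List.map_cons, List.prod_cons]
    rw [← mul_assoc (etaM a), ← etaM_expand]
    simp only [mul_assoc]
  refine ⟨?_, fun k hk hkn => ?_⟩
  · simpa [hp] using h.1
  · match k, hk, hkn with
    | 1, _, _ => simp [etaProd, etaM]
    | 2, _, _ => simp [etaProd, etaM]
    | k + 3, _, hkn =>
      rw [hp]
      exact h.2 _ (by omega) (by simp at hkn ⊢; omega)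

lemma IsEta.etaPos {c : List ℤ} (h : IsEta c) : EtaPos c := by
  induction h with
  | base =>
    refine ⟨?_, fun k hk hkn => ?_⟩
    · ext i j; fin_cases i <;> fin_cases j <;> simp [etaProd, etaM]
    · obtain rfl : k = 1 := by simp at hkn; omega
      simp [etaProd, etaM]
  | rotate _ ih => exact ih.rotate
  | reverse _ ih => exact ih.reverse
  | expand _ ih => exact ih.expand

lemma IsEta.small_or_pos {c : List ℤ} (h : IsEta c) :
    c = [0, 0] ∨ c = [1, 1, 1] ∨ (4 ≤ c.length ∧ ∀ a ∈ c, 1 ≤ a) := by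
  induction h with
  | base => simp
  | rotate _ ih =>
    rcases ih with rfl | rfl | ⟨h1, h2⟩
    · simp
    · simp
    · exact Or.inr (Or.inr ⟨by simpa using h1, by simpa using h2⟩)
  | reverse _ ih =>
    rcases ih with rfl | rfl | ⟨h1, h2⟩
    · simp
    · simp
    · exact Or.inr (Or.inr ⟨by simpa using h1, by simpa using h2⟩)
  | @expand a b t _ ih =>
    rcases ih with h | h | ⟨h1, h2⟩
    · simp at h; simp [h]
    · simp at h; simp [h]
    · simp at h1 h2
      refine Or.inr (Or.inr ⟨by simp; omega, ?_⟩)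
      simp only [List.mem_cons]
      rintro x (rfl | rfl | rfl | hx)
      · omega
      · omega
      · omega
      · exact h2.2.2 x hx

lemma etaPer_eq (c : List ℤ) {k : ℕ} (hk : k ≤ c.length) : etaPer c k = etaProd c k := by
  induction k with
  | zero => simp [etaPer, etaProd]
  | succ k ih =>
    rw [etaPer, ih (by omega), etaProd_succ c hk, Nat.mod_eq_of_lt hk]

lemma etaPer_add {c : List ℤ} (h : EtaPos c) (k : ℕ) :
    etaPer c (k + c.length) = - etaPer c k := by
  induction k with
  | zero => rw [zero_add, etaPer_eq c le_rfl, h.1, etaPer]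
  | succ k ih => rw [Nat.add_right_comm, etaPer, ih, etaPer, Nat.add_mod_right, neg_mul]

lemma perDet_add_right {c : List ℤ} (h : EtaPos c) (i j : ℕ) :
    perDet c i (j + c.length) = - perDet c i j := by
  simp [perDet, colDet, etaPer_add h]; ring

lemma perDet_swap (c : List ℤ) (i j : ℕ) : perDet c i j = - perDet c j i := by
  simp [perDet, colDet]; ring

lemma perDet_self (c : List ℤ) (i : ℕ) : perDet c i i = 0 := by
  simp [perDet, colDet]; ring

lemma abs_perDet_mod {c : List ℤ} (h : EtaPos c) (i j : ℕ) :
    |perDet c i (j % c.length)| = |perDet c i j| := by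
  rcases Nat.eq_zero_or_pos c.length with h0 | h0
  · simp [h0]
  induction j using Nat.strong_induction_on with
  | _ j ih =>
    rcases lt_or_ge j c.length with hj | hj
    · rw [Nat.mod_eq_of_lt hj]
    · obtain ⟨k, rfl⟩ := Nat.exists_eq_add_of_le' hj
      rw [Nat.add_mod_right, perDet_add_right h, abs_neg, ih k (by omega)]

lemma perDet_pos_of_lt {c : List ℤ} (h : EtaPos c) {i j : ℕ} (hij : i < j) (hj : j < c.length) :
    0 < perDet c i j := by
  rw [perDet, etaPer_eq c (by omega), etaPer_eq c (by omega)]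
  exact h.colDet_pos hij (by omega) (by omega)

lemma perDet_pos {c : List ℤ} (h : EtaPos c) {i j : ℕ} (hi : i < c.length) (hij : i < j)
    (hj : j < i + c.length) : 0 < perDet c i j := by
  rcases lt_or_ge j c.length with hj' | hj'
  · exact perDet_pos_of_lt h hij hj'
  · obtain ⟨k, rfl⟩ := Nat.exists_eq_add_of_le' hj'
    rw [perDet_add_right h, perDet_swap, neg_neg]
    exact perDet_pos_of_lt h (by omega) hi

lemma perDet_pos_of_window {c : List ℤ} (h : EtaPos c) {l j j' : ℕ} (hl : l < c.length)
    (hj : l < j) (hjj : j < j') (hj' : j' < l + c.length) : 0 < perDet c j j' := by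
  rcases lt_or_ge j c.length with hjc | hjc
  · exact perDet_pos h hjc hjj (by omega)
  · obtain ⟨d, rfl⟩ := Nat.exists_eq_add_of_le' hjc
    obtain ⟨d', rfl⟩ := Nat.exists_eq_add_of_le' (hjc.trans hjj.le)
    rw [perDet_add_right h, perDet_swap, neg_neg, perDet_add_right h, ← perDet_swap]
    exact perDet_pos_of_lt h (by omega) (by omega)

lemma perDet_rec (c : List ℤ) (i j : ℕ) :
    perDet c i j + perDet c i (j + 2) = c.getD ((j + 1) % c.length) 0 * perDet c i (j + 1) := by
  simp only [perDet, colDet, etaPer, etaM, Matrix.mul_apply, Fin.sum_univ_two, Matrix.of_apply,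
    Matrix.cons_val', Matrix.cons_val_zero, Matrix.cons_val_one, Matrix.cons_val_fin_one]
  ring

lemma perDet_plucker (c : List ℤ) (i j k l : ℕ) :
    perDet c i j * perDet c k l - perDet c i k * perDet c j l + perDet c i l * perDet c j k = 0 := by
  simp only [perDet, colDet]; ring

lemma phi_eq {c : List ℤ} (h : EtaPos c) {i j : ℕ} (hi : i < c.length) (hj : j < c.length) :
    phi c (i + 1) (j + 1) = |perDet c i j| := by
  rcases lt_trichotomy i j with hij | rfl | hij
  · rw [abs_of_pos (perDet_pos_of_lt h hij hj), perDet, etaPer_eq c hi.le, etaPer_eq c hj.le,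
      colDet_etaProd c hij.le]
    simp [phi, hij, hij.ne]
  · simp [phi, perDet_self]
  · rw [perDet_swap, abs_neg, abs_of_pos (perDet_pos_of_lt h hij hi), perDet, etaPer_eq c hi.le,
      etaPer_eq c hj.le, colDet_etaProd c hij.le]
    simp [phi, hij.not_gt, hij.ne']

lemma mem_mset_iff {c : List ℤ} (h : EtaPos c) {i j : ℕ} (hi : i < c.length) :
    j + 1 ∈ mset c (i + 1) ↔ j < c.length ∧ ∀ z, |perDet c i z| ≤ |perDet c i j| := by
  simp only [mset, Finset.mem_filter, Finset.mem_Icc]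
  constructor
  · rintro ⟨⟨_, hj⟩, hm⟩
    refine ⟨by omega, fun z => ?_⟩
    have hz : z % c.length < c.length := Nat.mod_lt _ (by omega)
    have := hm (z % c.length + 1) ⟨by omega, by omega⟩
    rwa [phi_eq h hi hz, phi_eq h hi (by omega), abs_perDet_mod h] at this
  · rintro ⟨hj, hm⟩
    refine ⟨⟨by omega, by omega⟩, fun z hz => ?_⟩
    obtain ⟨z, rfl⟩ := Nat.exists_eq_add_of_le' hz.1
    rw [phi_eq h hi (by omega), phi_eq h hi hj]
    exact hm z

lemma exists_window {c : List ℤ} (h : EtaPos c) {l a : ℕ} (hl : l < c.length) (ha : a < c.length)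
    (hal : a ≠ l) : ∃ j, l < j ∧ j < l + c.length ∧ j % c.length = a ∧
      perDet c l j = |perDet c l a| := by
  rcases lt_or_gt_of_ne hal with hal | hal
  · have := perDet_pos h hl (j := a + c.length) (by omega) (by omega)
    refine ⟨a + c.length, by omega, by omega, by simp [Nat.mod_eq_of_lt ha], ?_⟩
    rw [← abs_of_pos this, perDet_add_right h, abs_neg]
  · exact ⟨a, hal, by omega, Nat.mod_eq_of_lt ha, (abs_of_pos (perDet_pos_of_lt h hal ha)).symm⟩

/-- If `m_l` has more than one element, then its first element after `l` is an ear. -/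
lemma exists_first_ear {c : List ℤ} (h : EtaPos c) (hc : ∀ a ∈ c, 1 ≤ a) {l : ℕ}
    (hl : l < c.length) (hm : 1 < (mset c (l + 1)).card) :
    ∃ j j', l < j ∧ j < j' ∧ j' < l + c.length ∧ perDet c l j = perDet c l j' ∧
      (∀ z, |perDet c l z| ≤ perDet c l j) ∧ c.getD (j % c.length) 0 = 1 := by
  obtain ⟨a, ha, b, hb, hab⟩ := Finset.one_lt_card.mp hm
  have ha1 : 1 ≤ a := by simp [mset] at ha; omega
  have hb1 : 1 ≤ b := by simp [mset] at hb; omega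
  obtain ⟨a, rfl⟩ := Nat.exists_eq_add_of_le' ha1
  obtain ⟨b, rfl⟩ := Nat.exists_eq_add_of_le' hb1
  rw [mem_mset_iff h hl] at ha hb
  have hne : ∀ d, d < c.length → (∀ z, |perDet c l z| ≤ |perDet c l d|) → d ≠ l := by
    rintro d - hd rfl
    have h2 : a ≠ d ∨ b ≠ d := by omega
    have h3 : ∀ z, perDet c d z = 0 := by
      intro z; simpa [perDet_self] using hd z
    rcases h2 with h2 | h2
    · obtain ⟨j, hj1, hj2, -, -⟩ := exists_window h hl ha.1 h2
      exact (perDet_pos h hl hj1 hj2).ne' (h3 j)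
    · obtain ⟨j, hj1, hj2, -, -⟩ := exists_window h hl hb.1 h2
      exact (perDet_pos h hl hj1 hj2).ne' (h3 j)
  obtain ⟨p, hp1, hp2, hp3, hp4⟩ := exists_window h hl ha.1 (hne a ha.1 ha.2)
  obtain ⟨q, hq1, hq2, hq3, hq4⟩ := exists_window h hl hb.1 (hne b hb.1 hb.2)
  have hpq : p ≠ q := by rintro rfl; omega
  have hpq' : perDet c l p = perDet c l q := by
    rw [hp4, hq4]; exact le_antisymm (hb.2 a) (ha.2 b)
  have hbd : ∀ z, |perDet c l z| ≤ perDet c l p := by rw [hp4]; exact ha.2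
  have hex : ∃ j, l < j ∧ perDet c l j = perDet c l p := ⟨p, hp1, rfl⟩
  classical
  obtain ⟨hj1, hj2⟩ := Nat.find_spec hex
  have hjp : Nat.find hex ≤ p := Nat.find_min' hex ⟨hp1, rfl⟩
  have hjq : Nat.find hex ≤ q := Nat.find_min' hex ⟨hq1, hpq'.symm⟩
  have hmin : ∀ z, l < z → z < Nat.find hex → perDet c l z ≠ perDet c l p :=
    fun z h1 h2 h3 => Nat.find_min hex h2 ⟨h1, h3⟩
  generalize Nat.find hex = j at *
  have hMpos := perDet_pos h hl hp1 hp2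
  refine ⟨j, max p q, hj1, by omega, by omega, ?_, by rwa [hj2], ?_⟩
  · rcases max_choice p q with hx | hx <;> rw [hx, hj2]
    exact hpq'
  · have hge : 1 ≤ c.getD (j % c.length) 0 := by
      have : j % c.length < c.length := Nat.mod_lt _ (by omega)
      rw [List.getD_eq_getElem _ _ this]
      exact hc _ (List.getElem_mem this)
    obtain ⟨i, rfl⟩ := Nat.exists_eq_add_of_le' (show 1 ≤ j by omega)
    have hr := perDet_rec c l i
    have h1 : perDet c l i < perDet c l p := by
      rcases (show l ≤ i by omega).eq_or_lt with rfl | hli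
      · rwa [perDet_self]
      · exact lt_of_le_of_ne ((le_abs_self _).trans (hbd i)) (hmin i hli (by omega))
    have h2 : perDet c l (i + 2) ≤ perDet c l p := (le_abs_self _).trans (hbd _)
    rw [hj2] at hr
    by_contra hne1
    have : 2 ≤ c.getD ((i + 1) % c.length) 0 := by omega
    nlinarith

lemma perDet_of_mod_eq {c : List ℤ} (h : EtaPos c) {i j : ℕ} (hi : i < 2 * c.length)
    (hj : j < 2 * c.length) (hij : i % c.length = j % c.length) :
    ∃ s : ℤ, (s = 1 ∨ s = -1) ∧ ∀ z, perDet c z j = s * perDet c z i := by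
  have h0 : 0 < c.length := by omega
  have h1 := Nat.div_add_mod i c.length
  have h2 := Nat.div_add_mod j c.length
  have h3 : i / c.length < 2 := Nat.div_lt_of_lt_mul (by omega)
  have h4 : j / c.length < 2 := Nat.div_lt_of_lt_mul (by omega)
  interval_cases i / c.length <;> interval_cases j / c.length
  · exact ⟨1, by simp, fun z => by rw [show j = i by omega, one_mul]⟩
  · exact ⟨-1, by simp, fun z => by
      rw [show j = i + c.length by omega, perDet_add_right h, neg_one_mul]⟩
  · exact ⟨-1, by simp, fun z => by
      rw [show i = j + c.length by omega, perDet_add_right h, neg_one_mul, neg_neg]⟩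
  · exact ⟨1, by simp, fun z => by rw [show j = i by omega, one_mul]⟩

/-- `0 ≤ s * D(l₂, l)` if `j, j'` realize the maximum for `l` and `s • j` that for `l₂`. -/
lemma perDet_nonneg_of_max {c : List ℤ} {l l₂ j j' : ℕ} {s : ℤ} (hs : s = 1 ∨ s = -1)
    (hjj : perDet c l j = perDet c l j') (hM : 0 < perDet c l j) (hK : 0 < perDet c j j')
    (hmax : |perDet c l₂ j'| ≤ s * perDet c l₂ j) : 0 ≤ s * perDet c l₂ l := by
  have hp := perDet_plucker c l j j' l₂
  rw [← hjj, perDet_swap c j' l₂, perDet_swap c j l₂, perDet_swap c l l₂] at hp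
  have h1 : s * perDet c l₂ j' ≤ s * perDet c l₂ j := by
    rcases hs with rfl | rfl
    · exact (by simpa using le_abs_self _ : (1 : ℤ) * perDet c l₂ j' ≤ |perDet c l₂ j'|).trans hmax
    · exact (by simpa using neg_le_abs _ : (-1 : ℤ) * perDet c l₂ j' ≤ |perDet c l₂ j'|).trans hmax
  refine nonneg_of_mul_nonneg_right (a := perDet c j j') ?_ hK
  have h2 : perDet c j j' * (s * perDet c l₂ l) =
      perDet c l j * (s * perDet c l₂ j - s * perDet c l₂ j') := by
    linear_combination -s * hp
  rw [h2]
  exact mul_nonneg hM.le (by linarith)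

/-- In a cycle of length `n`, a vertex cover that is no larger than an independent set forces
the independent set to be alternating. -/
lemma alternating_of_card_le {n : ℕ} {G H : ℕ → Prop} [DecidablePred G] [DecidablePred H]
    (hG : ∀ i < n, G i ∨ G (i + 1)) (hGn : G n ↔ G 0)
    (hH : ∀ i < n, ¬ (H i ∧ H (i + 1))) (hHn : H n ↔ H 0)
    (hcard : #{i ∈ Finset.range n | G i} ≤ #{i ∈ Finset.range n | H i}) :
    ∀ i < n, H i ∨ H (i + 1) := by
  have key : ∀ (Q : ℕ → Prop) [DecidablePred Q], (Q n ↔ Q 0) →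
      ∑ i ∈ Finset.range n, ((if Q i then 1 else 0) + (if Q (i + 1) then 1 else 0)) =
        2 * #{i ∈ Finset.range n | Q i} := by
    intro Q _ hQ
    have h1 := Finset.sum_range_succ (fun i => if Q i then 1 else 0) n
    have h2 := Finset.sum_range_succ' (fun i => if Q i then 1 else 0) n
    simp only [hQ] at h1 h2
    rw [Finset.sum_add_distrib, Finset.card_filter]
    omega
  have kG := key G hGn
  have kH := key H hHn
  have hGs : ∑ i ∈ Finset.range n, 1 ≤
      ∑ i ∈ Finset.range n, ((if G i then 1 else 0) + (if G (i + 1) then 1 else 0)) := by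
    refine Finset.sum_le_sum fun i hi => ?_
    rcases hG i (Finset.mem_range.mp hi) with h | h <;> simp [h]
  by_contra! hcon
  obtain ⟨i, hi, hi1, hi2⟩ := hcon
  have hHs : ∑ i ∈ Finset.range n, ((if H i then 1 else 0) + (if H (i + 1) then 1 else 0)) <
      ∑ i ∈ Finset.range n, 1 := by
    refine Finset.sum_lt_sum (fun i hi => ?_) ⟨i, Finset.mem_range.mpr hi, by simp [hi1, hi2]⟩
    have := hH i (Finset.mem_range.mp hi)
    by_cases h1 : H i <;> by_cases h2 : H (i + 1) <;> simp_all
  omega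

/-- The index `j` (0-based, modulo `n`) is an ear at which some `φ_l` is maximal. -/
def IsMaxEar (c : List ℤ) (j : ℕ) : Prop :=
  c.getD (j % c.length) 0 = 1 ∧ ∃ l < c.length, ∀ z, |perDet c l z| ≤ |perDet c l j|

lemma isMaxEar_mod {c : List ℤ} (h : EtaPos c) (j : ℕ) :
    IsMaxEar c (j % c.length) ↔ IsMaxEar c j := by
  simp [IsMaxEar, abs_perDet_mod h]

lemma not_adjacent_ears {c : List ℤ} (h : EtaPos c) (hn : 4 ≤ c.length) {i : ℕ}
    (hi : i < c.length) (h1 : c.getD (i % c.length) 0 = 1) :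
    c.getD ((i + 1) % c.length) 0 ≠ 1 := by
  intro h2
  obtain ⟨k, hk, hki⟩ : ∃ k < c.length, (k + 1) % c.length = i % c.length := by
    rcases Nat.eq_zero_or_pos i with rfl | hi0
    · exact ⟨c.length - 1, by omega, by rw [Nat.sub_add_cancel (by omega)]; simp⟩
    · exact ⟨i - 1, by omega, by rw [Nat.sub_add_cancel (by omega)]⟩
  have hki' : (k + 2) % c.length = (i + 1) % c.length := by
    rw [show k + 2 = (k + 1) + 1 by ring, Nat.add_mod, hki, ← Nat.add_mod]
  have r1 := perDet_rec c k k
  have r2 := perDet_rec c k (k + 1)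
  rw [hki, h1, perDet_self] at r1
  rw [show k + 1 + 1 = k + 2 by ring, hki', h2] at r2
  have := perDet_pos h hk (j := k + 3) (by omega) (by omega)
  rw [show k + 1 + 2 = k + 3 by ring] at r2
  linarith

open Classical in
lemma card_le_card_isMaxEar {c : List ℤ} (h : EtaPos c) (hc : ∀ a ∈ c, 1 ≤ a) :
    #{l ∈ Finset.range c.length | 1 < (mset c (l % c.length + 1)).card} ≤
      #{j ∈ Finset.range c.length | IsMaxEar c j} := by
  have hex : ∀ l : ℕ, ∃ j j', l < c.length → 1 < (mset c (l % c.length + 1)).card →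
      l < j ∧ j < j' ∧ j' < l + c.length ∧ perDet c l j = perDet c l j' ∧
      (∀ z, |perDet c l z| ≤ perDet c l j) ∧ c.getD (j % c.length) 0 = 1 := by
    intro l
    by_cases hl : l < c.length ∧ 1 < (mset c (l % c.length + 1)).card
    · obtain ⟨j, j', hj⟩ := exists_first_ear h hc hl.1 (by simpa [Nat.mod_eq_of_lt hl.1] using hl.2)
      exact ⟨j, j', fun _ _ => hj⟩
    · exact ⟨0, 0, fun h1 h2 => absurd ⟨h1, h2⟩ hl⟩
  choose s t hst using hex
  refine Finset.card_le_card_of_injOn (fun l => s l % c.length) ?_ ?_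
  · intro l hl
    simp only [Finset.coe_filter, Finset.mem_range, Set.mem_ofPred_eq] at hl ⊢
    obtain ⟨h1, h2, h3, h4, h5, h6⟩ := hst l hl.1 hl.2
    refine ⟨Nat.mod_lt _ (by omega), (isMaxEar_mod h _).mpr ⟨h6, l, hl.1, fun z => ?_⟩⟩
    exact (h5 z).trans (le_abs_self _)
  · intro l hl l₂ hl₂ heq
    simp only [Finset.coe_filter, Finset.mem_range, Set.mem_ofPred_eq] at hl hl₂ heq
    obtain ⟨h1, h2, h3, h4, h5, h6⟩ := hst l hl.1 hl.2
    obtain ⟨k1, k2, k3, k4, k5, k6⟩ := hst l₂ hl₂.1 hl₂.2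
    obtain ⟨r, hr, hr'⟩ := perDet_of_mod_eq h (by omega) (by omega) heq
    have hrr : r * r = 1 := by rcases hr with rfl | rfl <;> norm_num
    have a1 : 0 ≤ r * perDet c l₂ l :=
      perDet_nonneg_of_max hr h4 (perDet_pos h hl.1 h1 (by omega)) (perDet_pos_of_window h hl.1 h1 h2 h3)
        (by rw [← hr']; exact k5 _)
    have a2 : 0 ≤ r * perDet c l l₂ :=
      perDet_nonneg_of_max hr k4 (perDet_pos h hl₂.1 k1 (by omega)) (perDet_pos_of_window h hl₂.1 k1 k2 k3)
        (by rw [hr', ← mul_assoc, hrr, one_mul]; exact h5 _)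
    rw [perDet_swap c l l₂] at a2
    have a3 : perDet c l₂ l = 0 := by rcases hr with rfl | rfl <;> omega
    rcases lt_trichotomy l l₂ with hlt | hlt | hlt
    · have := perDet_pos_of_lt h hlt hl₂.1
      rw [perDet_swap] at this
      omega
    · exact hlt
    · have := perDet_pos_of_lt h hlt hl.1
      omega

/-- A vector strictly inside a supporting edge is never extremal. -/
lemma max_of_between {c : List ℤ} (h : EtaPos c) {l e k f g : ℕ}
    (hek : e < k) (hkf : k < f) (hf : f < c.length) (hlef : l < e ∨ f < l) (hl : l < c.length)
    (hle : ∀ z, |perDet c l z| ≤ |perDet c l e|) (hlf : ∀ z, |perDet c l z| ≤ |perDet c l f|)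
    (hg : ∀ z, |perDet c g z| ≤ |perDet c g k|) (hgl : 0 < |perDet c g k|) :
    ∀ z, |perDet c l z| ≤ |perDet c l k| := by
  have p1 := perDet_pos_of_lt h hek (by omega)
  have p2 := perDet_pos_of_lt h hkf (by omega)
  have p3 := perDet_pos_of_lt h (hek.trans hkf) (by omega)
  have hEF : |perDet c l e| = |perDet c l f| := le_antisymm (hlf e) (hle f)
  have q : ∀ z, perDet c z k * perDet c e f =
      perDet c z e * perDet c k f + perDet c z f * perDet c e k := fun z => by
    linear_combination - perDet_plucker c z e k f
  have hsum : perDet c e f ≤ perDet c k f + perDet c e k := by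
    have h1 : |perDet c g k| * perDet c e f ≤ |perDet c g k| * (perDet c k f + perDet c e k) := by
      calc |perDet c g k| * perDet c e f = |perDet c g k * perDet c e f| := by
            rw [abs_mul, abs_of_pos p3]
        _ ≤ |perDet c g e| * perDet c k f + |perDet c g f| * perDet c e k := by
            rw [q g]
            refine (abs_add_le _ _).trans ?_
            rw [abs_mul, abs_mul, abs_of_pos p1, abs_of_pos p2]
        _ ≤ |perDet c g k| * perDet c k f + |perDet c g k| * perDet c e k :=
            add_le_add (mul_le_mul_of_nonneg_right (hg e) p2.le)
              (mul_le_mul_of_nonneg_right (hg f) p1.le)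
        _ = _ := by ring
    exact le_of_mul_le_mul_left h1 hgl
  have hq : |perDet c l k| * perDet c e f =
      |perDet c l e| * (perDet c k f + perDet c e k) := by
    rw [mul_add]
    nth_rw 2 [hEF]
    rcases hlef with hlt | hlt
    · rw [abs_of_pos (perDet_pos_of_lt h (hlt.trans hek) (by omega)),
        abs_of_pos (perDet_pos_of_lt h hlt (by omega)),
        abs_of_pos (perDet_pos_of_lt h (by omega : l < f) (by omega))]
      exact q l
    · have e1 := perDet_pos_of_lt h (by omega : e < l) hl
      have e2 := perDet_pos_of_lt h (by omega : k < l) hl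
      have e3 := perDet_pos_of_lt h (by omega : f < l) hl
      rw [perDet_swap] at e1 e2 e3
      rw [abs_of_neg (by omega : perDet c l k < 0), abs_of_neg (by omega : perDet c l e < 0),
        abs_of_neg (by omega : perDet c l f < 0)]
      linear_combination - q l
  intro z
  refine (hle z).trans (le_of_mul_le_mul_right ?_ p3)
  rw [hq]
  exact mul_le_mul_of_nonneg_left hsum (abs_nonneg _)

theorem mset_two_ears (c : List ℤ) (h : IsEta c) (hd : DenseSeq c)
    (e f : ℕ) (he1 : 1 ≤ e) (hef : e < f) (hf : f ≤ c.length)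
    (hee : entryOf c e = 1) (hfe : entryOf c f = 1)
    (l : ℕ) (hl : l ∈ Finset.Icc 1 c.length) (hlo : l ∉ Finset.Icc e f)
    (hml : mset c l = {e, f}) :
    c = [1, 1, 1] ∨ f = e + 2 := by
  have hP := h.etaPos
  rcases h.small_or_pos with rfl | rfl | ⟨hn, hc⟩
  · obtain ⟨rfl, rfl⟩ : e = 1 ∧ f = 2 := by simp at hf; omega
    simp [entryOf] at hee
  · exact Or.inl rfl
  right
  rw [Finset.mem_Icc] at hl hlo
  obtain ⟨e, rfl⟩ := Nat.exists_eq_add_of_le' he1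
  obtain ⟨f, rfl⟩ := Nat.exists_eq_add_of_le' (show 1 ≤ f by omega)
  obtain ⟨l, rfl⟩ := Nat.exists_eq_add_of_le' hl.1
  have hl' : l < c.length := by omega
  have he_mem := (mem_mset_iff hP hl' (j := e)).mp (by simp [hml])
  have hf_mem := (mem_mset_iff hP hl' (j := f)).mp (by simp [hml])
  have He : IsMaxEar c e :=
    ⟨by simpa [entryOf, Nat.mod_eq_of_lt he_mem.1] using hee, l, hl', he_mem.2⟩
  have Hf : IsMaxEar c f :=
    ⟨by simpa [entryOf, Nat.mod_eq_of_lt hf_mem.1] using hfe, l, hl', hf_mem.2⟩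
  have hnadj : ∀ i < c.length, ¬ (IsMaxEar c i ∧ IsMaxEar c (i + 1)) :=
    fun i hi hi' => not_adjacent_ears hP hn hi hi'.1.1 hi'.2.1
  classical
  have halt := alternating_of_card_le (n := c.length)
    (G := fun l => 1 < (mset c (l % c.length + 1)).card) (H := IsMaxEar c)
    (fun i hi => by
      have := hd (i + 1) (Finset.mem_Icc.mpr ⟨by omega, by omega⟩)
      rw [Nat.mod_eq_of_lt hi]
      refine this.imp id fun h2 => ?_
      rcases (show i + 1 ≤ c.length by omega).eq_or_lt with h3 | h3
      · rw [addIdx, if_neg (by omega), show i + 1 + 1 - c.length = 1 by omega] at h2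
        simpa [h3] using h2
      · rw [addIdx, if_pos (by omega)] at h2
        simpa [Nat.mod_eq_of_lt h3] using h2)
    (by simp) hnadj (by rw [← isMaxEar_mod hP, Nat.mod_self])
    (card_le_card_isMaxEar hP hc)
  have hf1 : f ≠ e + 1 := by
    rintro rfl
    exact hnadj e he_mem.1 ⟨He, Hf⟩
  by_contra hf2
  have Hk : IsMaxEar c (e + 2) :=
    (halt (e + 1) (by omega)).resolve_left fun h1 => hnadj e he_mem.1 ⟨He, h1⟩
  obtain ⟨-, g, hg, hgk⟩ := Hk
  have hgl : 0 < |perDet c g (e + 2)| :=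
    (abs_pos.mpr (perDet_pos hP hg (j := g + 1) (by omega) (by omega)).ne').trans_le (hgk (g + 1))
  have hk := max_of_between hP (by omega : e < e + 2) (by omega : e + 2 < f) hf_mem.1 (by omega)
    hl' he_mem.2 hf_mem.2 hgk hgl
  have hmem := (mem_mset_iff hP hl' (j := e + 2)).mpr ⟨by omega, hk⟩
  rw [hml] at hmem
  simp at hmem
  omega
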